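/- arXiv:2605.02610 — 3 statements merged into one kernel-verified Lean document; each statement's English description precedes it below -/
import Mathlib

section
/- Let k > ℓ ≥ 2 and t ≥ k-1 be integers, and let G be an ℓ-graph on n vertices in which every vertex is contained in at least C(t, k-1) copies of K_k^ℓ. Then ℓ·|E(G)| ≥ n·C(t, ℓ-1); equivalently, |E(G)| ≥ (n/ℓ)·C(t, ℓ-1). -/
open Finset

open scoped Classical

/-- `E` is the edge set of an `ℓ`-uniform hypergraph on vertex type `V`:
every edge is an `ℓ`-element set. -/
def IsLGraph {V : Type*} (ℓ : ℕ) (E : Finset (Finset V)) : Prop :=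
  ∀ e ∈ E, e.card = ℓ

/-- `S` is a copy of `K_k^ℓ` in the hypergraph with edge set `E`:
`S` has `k` vertices and every `ℓ`-element subset of `S` is an edge. -/
def IsCopy {V : Type*} (E : Finset (Finset V)) (ℓ k : ℕ) (S : Finset V) : Prop :=
  S.card = k ∧ ∀ e ⊆ S, e.card = ℓ → e ∈ E

/-- The number of copies of `K_k^ℓ` containing the vertex `v`. -/
noncomputable def copiesAt {V : Type*} [Fintype V] (E : Finset (Finset V)) (ℓ k : ℕ)
    (v : V) : ℕ :=
  ((univ : Finset (Finset V)).filter fun S => v ∈ S ∧ IsCopy E ℓ k S).card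

/-- The degree of a vertex: the number of edges containing it. -/
noncomputable def hdeg {V : Type*} (E : Finset (Finset V)) (v : V) : ℕ :=
  (E.filter fun e => v ∈ e).card

/-- The `(t,k)`-degree condition: every vertex is contained in at least
`C(t, k-1)` copies of `K_k^ℓ`. -/
def DegCond {V : Type*} [Fintype V] (E : Finset (Finset V)) (ℓ k t : ℕ) : Prop :=
  ∀ v : V, Nat.choose t (k - 1) ≤ copiesAt E ℓ k v

/-- `E` is extremal: it is an `ℓ`-graph satisfying the `(t,k)`-degree condition
with the minimum number of edges among all such `ℓ`-graphs on the same vertex set. -/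
def IsExtremal {V : Type*} [Fintype V] (E : Finset (Finset V)) (ℓ k t : ℕ) : Prop :=
  IsLGraph ℓ E ∧ DegCond E ℓ k t ∧
    ∀ E' : Finset (Finset V), IsLGraph ℓ E' → DegCond E' ℓ k t → E.card ≤ E'.card

/-- `A` is an isolated copy of `K_{t+1}^ℓ`: it is a copy of `K_{t+1}^ℓ` and
every edge meeting `A` is contained in `A`. -/
def IsIsolatedCopy {V : Type*} [DecidableEq V] (E : Finset (Finset V)) (ℓ t : ℕ)
    (A : Finset V) : Prop :=
  IsCopy E ℓ (t + 1) A ∧ ∀ e ∈ E, (e ∩ A).Nonempty → e ⊆ A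

/-- The Lovász form of the Kruskal-Katona theorem over an arbitrary finite ground set. -/
theorem Finset.kruskal_katona_lovasz_form_of_fintype {V : Type*} [DecidableEq V] [Fintype V]
    {𝒜 : Finset (Finset V)} {i r t : ℕ} (hir : i ≤ r) (hrt : r ≤ t)
    (hsized : (𝒜 : Set (Finset V)).Sized r) (hcard : t.choose r ≤ 𝒜.card) :
    t.choose (r - i) ≤ (Finset.shadow^[i] 𝒜).card := by
  let f : V ↪ Fin (Fintype.card V + t) :=
    (Fintype.equivFin V).toEmbedding.trans (Fin.castAddEmb t)
  have key := kruskal_katona_lovasz_form (𝒜 := 𝒜.map (mapEmbedding f).toEmbedding) hir hrt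
    (Nat.le_add_left t _) (by
      intro A hA
      obtain ⟨B, hB, rfl⟩ := mem_map.1 hA
      simpa using hsized hB) (by simpa using hcard)
  refine key.trans ?_
  rw [← card_map (mapEmbedding f).toEmbedding]
  refine card_le_card fun A hA ↦ ?_
  obtain ⟨B, hB, hAB, hdiff⟩ := mem_shadow_iterate_iff_exists_sdiff.1 hA
  obtain ⟨S, hS, rfl⟩ := mem_map.1 hB
  obtain ⟨T, hTS, rfl⟩ := subset_map_iff.1 hAB
  refine mem_map_of_mem _ (mem_shadow_iterate_iff_exists_sdiff.2 ⟨S, hS, hTS, ?_⟩)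
  simpa [← map_sdiff] using hdiff

/-- A vertex in at least `C(t, k-1)` copies of `K_k^ℓ` has degree at least `C(t, ℓ-1)`: apply
Kruskal-Katona to the copies through `v` with `v` removed. -/
theorem choose_le_hdeg {V : Type*} [Fintype V] {E : Finset (Finset V)} {k ℓ t : ℕ} {v : V}
    (hkl : ℓ ≤ k) (hl : 1 ≤ ℓ) (ht : k - 1 ≤ t) (hv : t.choose (k - 1) ≤ copiesAt E ℓ k v) :
    t.choose (ℓ - 1) ≤ hdeg E v := by
  have herase : Set.InjOn (fun S : Finset V ↦ S.erase v) {S | v ∈ S} :=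
    fun S hS T hT h ↦ erase_injOn' v hS hT h
  set 𝒜 := ((univ : Finset (Finset V)).filter fun S ↦ v ∈ S ∧ IsCopy E ℓ k S).image
    fun S ↦ S.erase v with h𝒜
  have hcard : t.choose (k - 1) ≤ 𝒜.card := by
    rw [h𝒜, card_image_of_injOn (herase.mono fun S hS ↦ (mem_filter.1 hS).2.1)]
    exact hv
  have hsized : (𝒜 : Set (Finset V)).Sized (k - 1) := by
    intro A hA
    obtain ⟨S, hS, rfl⟩ := mem_image.1 hA
    obtain ⟨-, hvS, hcS, -⟩ := mem_filter.1 hS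
    rw [card_erase_of_mem hvS, hcS]
  have key := kruskal_katona_lovasz_form_of_fintype (i := k - ℓ) (by omega) ht hsized hcard
  rw [show k - 1 - (k - ℓ) = ℓ - 1 by omega] at key
  refine key.trans (card_le_card_of_injOn (insert v) ?_ ?_)
  · intro T hT
    have hTcard := hsized.shadow_iterate hT
    obtain ⟨A, hA, hTA, -⟩ := mem_shadow_iterate_iff_exists_sdiff.1 hT
    obtain ⟨S, hS, rfl⟩ := mem_image.1 hA
    obtain ⟨-, hvS, -, hSE⟩ := mem_filter.1 hS
    have hvT : v ∉ T := fun h ↦ notMem_erase v S (hTA h)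
    refine mem_filter.2 ⟨hSE _ ?_ ?_, mem_insert_self v T⟩
    · exact insert_subset hvS (hTA.trans (erase_subset v S))
    · rw [card_insert_of_notMem hvT, hTcard]
      omega
  · have hnot : ∀ T ∈ shadow^[k - ℓ] 𝒜, v ∉ T := by
      intro T hT h
      obtain ⟨A, hA, hTA, -⟩ := mem_shadow_iterate_iff_exists_sdiff.1 hT
      obtain ⟨S, -, rfl⟩ := mem_image.1 hA
      exact notMem_erase v S (hTA h)
    intro T hT U hU h
    rw [← erase_insert (hnot T hT), ← erase_insert (hnot U hU)]
    exact congrArg (fun S ↦ S.erase v) h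

/-- Handshake lemma: the degrees of an `ℓ`-graph sum to `ℓ` times its number of edges. -/
theorem sum_hdeg {V : Type*} [Fintype V] {E : Finset (Finset V)} {ℓ : ℕ} (hE : IsLGraph ℓ E) :
    ∑ v, hdeg E v = ℓ * E.card := by
  have h := sum_card_bipartiteAbove_eq_sum_card_bipartiteBelow
    (s := (univ : Finset V)) (t := E) (fun v e ↦ v ∈ e)
  simp only [bipartiteAbove, bipartiteBelow, filter_univ_mem] at h
  rw [sum_congr rfl hE, sum_const, smul_eq_mul, mul_comm] at h
  exact h

/-- If every vertex of an `ℓ`-graph on `n` vertices is contained in at least `C(t,k-1)`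
copies of `K_k^ℓ`, then `ℓ·|E| ≥ n·C(t, ℓ-1)`; equivalently `|E| ≥ (n/ℓ)·C(t,ℓ-1)`. -/
theorem stmt3 (k ℓ t n : ℕ) (hkl : ℓ < k) (hl : 2 ≤ ℓ) (ht : k - 1 ≤ t)
    (V : Type*) [DecidableEq V] [Fintype V] (hcard : Fintype.card V = n)
    (E : Finset (Finset V)) (hE : IsLGraph ℓ E) (hdc : DegCond E ℓ k t) :
    n * Nat.choose t (ℓ - 1) ≤ ℓ * E.card ∧
      ((n : ℚ) / (ℓ : ℚ)) * (Nat.choose t (ℓ - 1) : ℚ) ≤ (E.card : ℚ) := by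
  have hmain : n * t.choose (ℓ - 1) ≤ ℓ * E.card := by
    rw [← sum_hdeg hE, ← hcard, ← smul_eq_mul, ← card_univ]
    exact card_nsmul_le_sum _ _ _ fun v _ ↦ choose_le_hdeg hkl.le (by omega) ht (hdc v)
  refine ⟨hmain, ?_⟩
  have hℓ : (0 : ℚ) < ℓ := by exact_mod_cast (by omega : 0 < ℓ)
  rw [div_mul_eq_mul_div, div_le_iff₀' hℓ]
  exact_mod_cast hmain
end

section
/- Let k > ℓ ≥ 2 and t ≥ k-1 be integers, and write n = q(t+1) + r with q ≥ 1 and 0 ≤ r < t+1. Then there exists an ℓ-graph G' on n vertices in which every vertex is contained in at least C(t, k-1) copies of K_k^ℓ and whose number of edges satisfies ℓ·|E(G')| = n·C(t, ℓ-1) + (t+1-r)·( C(t, ℓ-1) − C(t-r, ℓ-1) ). Consequently, the minimum number of edges of an ℓ-graph on n vertices satisfying this degree condition is at most |E(G')|. -/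
open Finset

open scoped Classical

/-- The vertices of `Fin n` whose value lies in the interval `[a, b)`. -/
def finInterval (n a b : ℕ) : Finset (Fin n) :=
  univ.filter fun v => a ≤ v.val ∧ v.val < b

lemma mem_finInterval {n a b : ℕ} {v : Fin n} :
    v ∈ finInterval n a b ↔ a ≤ v.val ∧ v.val < b := by
  simp [finInterval]

lemma card_finInterval {n a b : ℕ} (hb : b ≤ n) : (finInterval n a b).card = b - a := by
  rw [← Nat.card_Ico, ← Finset.card_map Fin.valEmbedding]
  congr 1
  ext x
  simp only [mem_map, mem_finInterval, Fin.valEmbedding_apply, mem_Ico]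
  constructor
  · rintro ⟨v, hv, rfl⟩
    exact hv
  · intro hx
    exact ⟨⟨x, by omega⟩, hx, rfl⟩

/-- A vertex of a complete `ℓ`-graph on `t + 1` vertices lies in at least `C(t, k-1)` copies
of `K_k^ℓ`. -/
lemma choose_le_copiesAt {V : Type*} [Fintype V] {E : Finset (Finset V)} {ℓ k t : ℕ}
    (hk : 1 ≤ k) {T : Finset V} (hT : IsCopy E ℓ (t + 1) T) {v : V} (hv : v ∈ T) :
    Nat.choose t (k - 1) ≤ copiesAt E ℓ k v := by
  have hcard : (T.erase v).card = t := by rw [card_erase_of_mem hv, hT.1]; rfl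
  rw [← hcard, ← card_powersetCard]
  refine card_le_card_of_injOn (insert v) ?_ ?_
  · intro S hS
    obtain ⟨hST, hSc⟩ := mem_powersetCard.1 (mem_coe.1 hS)
    have hvS : v ∉ S := fun h => notMem_erase v T (hST h)
    have hsub : insert v S ⊆ T :=
      insert_subset hv (hST.trans (erase_subset v T))
    refine mem_coe.2 (mem_filter.2 ⟨mem_univ _, mem_insert_self v S, ?_, ?_⟩)
    · rw [card_insert_of_notMem hvS, hSc]
      omega
    · exact fun e he => hT.2 e (he.trans hsub)
  · intro S hS S' hS' h
    have hvS : v ∉ S := fun h => notMem_erase v T ((mem_powersetCard.1 (mem_coe.1 hS)).1 h)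
    have hvS' : v ∉ S' := fun h => notMem_erase v T ((mem_powersetCard.1 (mem_coe.1 hS')).1 h)
    rw [← erase_insert hvS, ← erase_insert hvS']
    exact congrArg (fun U => U.erase v) h

lemma powersetCard_inter {V : Type*} [DecidableEq V] (m : ℕ) (A B : Finset V) :
    powersetCard m A ∩ powersetCard m B = powersetCard m (A ∩ B) := by
  ext e
  simp only [mem_inter, mem_powersetCard, subset_inter_iff]
  tauto

lemma disjoint_powersetCard {V : Type*} [DecidableEq V] {m : ℕ} (hm : m ≠ 0) {A B : Finset V}
    (h : Disjoint A B) : Disjoint (powersetCard m A) (powersetCard m B) := by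
  rw [disjoint_iff_inter_eq_empty] at h ⊢
  rw [powersetCard_inter, h, powersetCard_eq_empty, card_empty]
  omega

lemma disjoint_finInterval {n a b c d : ℕ} (h : b ≤ c) :
    Disjoint (finInterval n a b) (finInterval n c d) := by
  rw [disjoint_left]
  intro v hv hv'
  rw [mem_finInterval] at hv hv'
  omega

lemma finInterval_inter {n a b c d : ℕ} :
    finInterval n a b ∩ finInterval n c d = finInterval n (max a c) (min b d) := by
  ext v
  simp only [mem_inter, mem_finInterval]
  omega

lemma mul_choose_eq {m ℓ : ℕ} (hm : 1 ≤ m) (hl : 1 ≤ ℓ) :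
    ℓ * Nat.choose m ℓ = m * Nat.choose (m - 1) (ℓ - 1) := by
  obtain ⟨m, rfl⟩ := Nat.exists_eq_add_of_le' hm
  obtain ⟨ℓ, rfl⟩ := Nat.exists_eq_add_of_le' hl
  rw [Nat.add_sub_cancel, Nat.add_sub_cancel, Nat.add_one_mul_choose_eq, mul_comm]

/-- The union of the complete `ℓ`-graphs on the first `q` consecutive intervals of length `s`
in `Fin n`. -/
def consecutiveCliques (n ℓ s q : ℕ) : Finset (Finset (Fin n)) :=
  (range q).biUnion fun i => powersetCard ℓ (finInterval n (i * s) ((i + 1) * s))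

lemma card_consecutiveCliques {n ℓ s q : ℕ} (hl : ℓ ≠ 0) (hn : q * s ≤ n) :
    (consecutiveCliques n ℓ s q).card = q * Nat.choose s ℓ := by
  unfold consecutiveCliques
  rw [card_biUnion]
  · rw [sum_congr rfl (g := fun _ => Nat.choose s ℓ), sum_const, card_range, smul_eq_mul]
    intro i hi
    have h : (i + 1) * s ≤ n :=
      (Nat.mul_le_mul_right s (Nat.succ_le_of_lt (mem_range.1 hi))).trans hn
    rw [card_powersetCard, card_finInterval h, Nat.add_mul, one_mul, Nat.add_sub_cancel_left]
  · intro i _ j _ hij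
    refine disjoint_powersetCard hl ?_
    rcases lt_or_gt_of_ne hij with h | h
    · exact disjoint_finInterval (Nat.mul_le_mul_right s h)
    · exact (disjoint_finInterval (Nat.mul_le_mul_right s h)).symm

lemma consecutiveCliques_inter {n ℓ s q a : ℕ} (hl : ℓ ≠ 0) (ha : q * s ≤ a)
    (ha' : a ≤ (q + 1) * s) (hn : (q + 1) * s ≤ n) :
    consecutiveCliques n ℓ s (q + 1) ∩ powersetCard ℓ (finInterval n a n) =
      powersetCard ℓ (finInterval n a ((q + 1) * s)) := by
  have hlast : finInterval n (q * s) ((q + 1) * s) ∩ finInterval n a n =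
      finInterval n a ((q + 1) * s) := by
    rw [finInterval_inter, max_eq_right ha, min_eq_left hn]
  ext e
  simp only [mem_inter, consecutiveCliques, mem_biUnion, mem_range]
  constructor
  · rintro ⟨⟨i, hi, hei⟩, he⟩
    rcases Nat.lt_succ_iff_lt_or_eq.1 hi with h | rfl
    · exact absurd he (disjoint_left.1 (disjoint_powersetCard hl
        (disjoint_finInterval ((Nat.mul_le_mul_right s h).trans ha))) hei)
    · rw [← hlast, ← powersetCard_inter]
      exact mem_inter.2 ⟨hei, he⟩
  · intro he
    rw [← hlast, ← powersetCard_inter, mem_inter] at he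
    exact ⟨⟨q, Nat.lt_succ_self q, he.1⟩, he.2⟩

/-- If `n = q(t+1) + r` with `q ≥ 1` and `0 ≤ r < t+1`, there is an `ℓ`-graph `G'` on `n`
vertices satisfying the `(t,k)`-degree condition with
`ℓ·|E(G')| = n·C(t,ℓ-1) + (t+1-r)(C(t,ℓ-1) − C(t-r,ℓ-1))`; consequently the minimum
number of edges under this degree condition is at most `|E(G')|`. -/
theorem stmt5 (k ℓ t q r n : ℕ) (hkl : ℓ < k) (hl : 2 ≤ ℓ) (ht : k - 1 ≤ t)
    (hq : 1 ≤ q) (hr : r < t + 1) (hn : n = q * (t + 1) + r) :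
    ∃ E' : Finset (Finset (Fin n)), IsLGraph ℓ E' ∧ DegCond E' ℓ k t ∧
      ℓ * E'.card = n * Nat.choose t (ℓ - 1) +
        (t + 1 - r) * (Nat.choose t (ℓ - 1) - Nat.choose (t - r) (ℓ - 1)) ∧
      ∀ E₀ : Finset (Finset (Fin n)), IsExtremal E₀ ℓ k t → E₀.card ≤ E'.card := by
  have hl0 : ℓ ≠ 0 := by omega
  have hqn : q * (t + 1) ≤ n := by omega
  have htn : t + 1 ≤ n := (Nat.le_mul_of_pos_left (t + 1) hq).trans hqn
  refine ⟨consecutiveCliques n ℓ (t + 1) q ∪ powersetCard ℓ (finInterval n (n - (t + 1)) n),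
    ?_⟩
  set E := consecutiveCliques n ℓ (t + 1) q ∪
    powersetCard ℓ (finInterval n (n - (t + 1)) n) with hE
  have hgraph : IsLGraph ℓ E := by
    intro e he
    rcases mem_union.1 he with he | he
    · obtain ⟨i, _, he⟩ := mem_biUnion.1 he
      exact (mem_powersetCard.1 he).2
    · exact (mem_powersetCard.1 he).2
  have hcond : DegCond E ℓ k t := by
    intro v
    by_cases hv : v.val < q * (t + 1)
    · have hi : v.val / (t + 1) < q := (Nat.div_lt_iff_lt_mul (Nat.succ_pos t)).2 hv
      have hin : (v.val / (t + 1) + 1) * (t + 1) ≤ n :=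
        (Nat.mul_le_mul_right (t + 1) hi).trans hqn
      refine choose_le_copiesAt (by omega) (T := finInterval n (v.val / (t + 1) * (t + 1))
        ((v.val / (t + 1) + 1) * (t + 1))) ⟨?_, fun e he hc => ?_⟩ ?_
      · rw [card_finInterval hin, Nat.add_mul, one_mul, Nat.add_sub_cancel_left]
      · exact mem_union_left _ (mem_biUnion.2
          ⟨_, mem_range.2 hi, mem_powersetCard.2 ⟨he, hc⟩⟩)
      · exact mem_finInterval.2 ⟨Nat.div_mul_le_self _ _,
          Nat.lt_mul_of_div_lt (Nat.lt_succ_self _) (Nat.succ_pos t)⟩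
    · refine choose_le_copiesAt (by omega) (T := finInterval n (n - (t + 1)) n)
        ⟨?_, fun e he hc => ?_⟩ ?_
      · rw [card_finInterval le_rfl]
        omega
      · exact mem_union_right _ (mem_powersetCard.2 ⟨he, hc⟩)
      · exact mem_finInterval.2 ⟨by omega, v.isLt⟩
  refine ⟨hgraph, hcond, ?_, fun E₀ h₀ => h₀.2.2 E hgraph hcond⟩
  have hinter : (consecutiveCliques n ℓ (t + 1) q ∩
      powersetCard ℓ (finInterval n (n - (t + 1)) n)).card = Nat.choose (t + 1 - r) ℓ := by
    obtain ⟨p, rfl⟩ := Nat.exists_eq_add_of_le' hq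
    have hp : (p + 1) * (t + 1) = p * (t + 1) + (t + 1) := by ring
    rw [consecutiveCliques_inter hl0 (by omega) (by omega) hqn, card_powersetCard,
      card_finInterval hqn]
    congr 1
    omega
  have hcard := card_union_add_card_inter (consecutiveCliques n ℓ (t + 1) q)
    (powersetCard ℓ (finInterval n (n - (t + 1)) n))
  rw [hinter, card_consecutiveCliques hl0 hqn, card_powersetCard, card_finInterval le_rfl,
    Nat.sub_sub_self htn, ← hE] at hcard
  have h₁ : ℓ * Nat.choose (t + 1) ℓ = (t + 1) * Nat.choose t (ℓ - 1) :=
    mul_choose_eq (by omega) (by omega)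
  have h₂ : ℓ * Nat.choose (t + 1 - r) ℓ = (t + 1 - r) * Nat.choose (t - r) (ℓ - 1) := by
    rw [mul_choose_eq (by omega) (by omega), show t + 1 - r - 1 = t - r by omega]
  obtain ⟨d, hd⟩ := Nat.exists_eq_add_of_le
    (Nat.choose_le_choose (ℓ - 1) (Nat.sub_le t r))
  obtain ⟨m, hm⟩ := Nat.exists_eq_add_of_le hr.le
  have hm' : t + 1 - r = m := by omega
  rw [hm'] at h₂ hcard ⊢
  have hsub : Nat.choose t (ℓ - 1) - Nat.choose (t - r) (ℓ - 1) = d := by omega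
  rw [hsub]
  zify at hn hcard h₁ h₂ hd hm ⊢
  linear_combination (ℓ : ℤ) * hcard + ((q : ℤ) + 1) * h₁ - h₂ +
    (Nat.choose t (ℓ - 1) : ℤ) * (hm - hn) + (m : ℤ) * hd
end

section
/- For all integers k > ℓ ≥ 2 there exists an integer t₀ such that for every integer t ≥ t₀ the following holds. Let n > (1/4)(t+1)²·C(t-1, ℓ-2) + 2t and let G be an extremal ℓ-graph on n vertices for the (t,k)-degree condition. If A₁ and A₂ are two distinct (t+1)-element vertex sets that are both copies of K_{t+1}^ℓ in G, then G contains no edge e ⊆ A₁ ∪ A₂ with e ∩ (A₁ \ A₂) ≠ ∅ and e ∩ (A₂ \ A₁) ≠ ∅. -/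
open Finset

open scoped Classical

theorem exists_isInitSeg_card {m r s : ℕ} (h : s ≤ m.choose r) :
    ∃ 𝒞 : Finset (Finset (Fin m)), Colex.IsInitSeg 𝒞 r ∧ #𝒞 = s := by
  induction s with
  | zero => exact ⟨∅, Colex.isInitSeg_empty, rfl⟩
  | succ s ih =>
    obtain ⟨𝒞, h𝒞, hs⟩ := ih (by omega)
    have hne : ((univ : Finset (Fin m)).powersetCard r \ 𝒞).Nonempty := by
      rw [← card_pos]
      have := le_card_sdiff 𝒞 ((univ : Finset (Fin m)).powersetCard r)
      rw [card_powersetCard, card_univ, Fintype.card_fin] at this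
      omega
    obtain ⟨x, hx, hmin⟩ := exists_min_image _ (fun S : Finset (Fin m) => toColex S) hne
    simp only [mem_sdiff, mem_powersetCard, subset_univ, true_and] at hx hmin
    refine ⟨insert x 𝒞, ⟨?_, ?_⟩, by rw [card_insert_of_notMem hx.2, hs]⟩
    · intro S hS
      rcases mem_insert.1 hS with rfl | hS
      · exact hx.1
      · exact h𝒞.1 hS
    · rintro S T hS ⟨hTS, hT⟩
      rcases mem_insert.1 hS with rfl | hS
      · by_contra hn
        exact absurd hTS (not_lt.2 (hmin T ⟨hT, fun h => hn (mem_insert_of_mem h)⟩))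
      · exact mem_insert_of_mem (h𝒞.2 hS ⟨hTS, hT⟩)

theorem isInitSeg_shadow_iterate {m r : ℕ} {𝒞 : Finset (Finset (Fin m))}
    (h : Colex.IsInitSeg 𝒞 r) (i : ℕ) : Colex.IsInitSeg (shadow^[i] 𝒞) (r - i) := by
  induction i with
  | zero => exact h
  | succ i ih =>
    rw [Function.iterate_succ_apply', Nat.sub_succ]
    exact ih.shadow

theorem isInitSeg_subset_of_card_le {m r : ℕ} {𝒞 𝒟 : Finset (Finset (Fin m))}
    (h𝒞 : Colex.IsInitSeg 𝒞 r) (h𝒟 : Colex.IsInitSeg 𝒟 r) (h : #𝒞 ≤ #𝒟) : 𝒞 ⊆ 𝒟 := by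
  rcases h𝒞.total h𝒟 with h' | h'
  · exact h'
  · exact (eq_of_subset_of_card_le h' h).ge

theorem isInitSeg_powersetCard_lt {m : ℕ} (a r : ℕ) :
    Colex.IsInitSeg (({i : Fin m | (i : ℕ) < a} : Finset (Fin m)).powersetCard r) r := by
  refine ⟨fun S hS => (mem_powersetCard.1 hS).2, ?_⟩
  rintro S T hS ⟨hTS, hT⟩
  refine mem_powersetCard.2 ⟨fun i hi => ?_, hT⟩
  have hS' := (mem_powersetCard.1 hS).1
  obtain ⟨j, hj, hij⟩ : ∃ j ∈ S, i ≤ j := by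
    by_contra! hn
    exact lt_irrefl _ (Colex.forall_lt_mono hTS.le hn i hi)
  have := hS' hj
  simp only [mem_filter, mem_univ, true_and] at this ⊢
  exact lt_of_le_of_lt hij this

theorem subset_mem_of_isInitSeg {m r j : ℕ} {𝒯 𝒢 𝒞 𝒟 : Finset (Finset (Fin m))}
    (h𝒯 : (𝒯 : Set (Finset (Fin m))).Sized r) (h : ∀ T ∈ 𝒯, ∀ S ⊆ T, #S = j → S ∈ 𝒢)
    (h𝒞 : Colex.IsInitSeg 𝒞 r) (h𝒟 : Colex.IsInitSeg 𝒟 j) (hc : #𝒞 ≤ #𝒯) (hd : #𝒢 ≤ #𝒟)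
    {T S : Finset (Fin m)} (hT : T ∈ 𝒞) (hST : S ⊆ T) (hS : #S = j) : S ∈ 𝒟 := by
  have hTr := h𝒞.1 hT
  have hjr : j ≤ r := by rw [← hS, ← hTr]; exact card_le_card hST
  have hsub : shadow^[r - j] 𝒯 ⊆ 𝒢 := by
    intro R hR
    obtain ⟨T', hT', hRT, hcard⟩ := mem_shadow_iterate_iff_exists_mem_card_add.1 hR
    have := h𝒯 hT'
    exact h T' hT' R hRT (by omega)
  have hseg := isInitSeg_shadow_iterate h𝒞 (r - j)
  rw [Nat.sub_sub_self hjr] at hseg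
  refine isInitSeg_subset_of_card_le hseg h𝒟
    ((iterated_kk h𝒯 hc h𝒞).trans ((card_le_card hsub).trans hd)) ?_
  exact mem_shadow_iterate_iff_exists_mem_card_add.2 ⟨T, hT, hST, by omega⟩

theorem exists_enumeration {V : Type*} [DecidableEq V] {U A : Finset V} (hA : A ⊆ U) :
    ∃ g : Fin #U ↪ V,
      univ.map g = U ∧ ({i | (i : ℕ) < #A} : Finset (Fin #U)).map g = A := by
  have hlen : (A.toList ++ (U \ A).toList).length = #U := by
    simp [card_sdiff_of_subset hA, card_le_card hA]
  have hnd : (A.toList ++ (U \ A).toList).Nodup := by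
    refine List.Nodup.append A.nodup_toList (U \ A).nodup_toList fun x hx hx' => ?_
    rw [mem_toList] at hx hx'
    exact (mem_sdiff.1 hx').2 hx
  have hf : Function.Injective fun i : Fin #U =>
      (A.toList ++ (U \ A).toList)[(i : ℕ)]'(i.2.trans_eq hlen.symm) :=
    fun i j hij => Fin.ext (hnd.getElem_inj_iff.1 hij)
  refine ⟨⟨_, hf⟩, ?_, ?_⟩
  · refine eq_of_subset_of_card_le (fun x hx => ?_) (by simp)
    obtain ⟨i, -, rfl⟩ := mem_map.1 hx
    have := List.getElem_mem (l := A.toList ++ (U \ A).toList) (i.2.trans_eq hlen.symm)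
    simp only [List.mem_append, mem_toList, mem_sdiff] at this
    exact this.elim (fun h => hA h) And.left
  · ext x
    simp only [mem_map, mem_filter, mem_univ, true_and]
    constructor
    · rintro ⟨i, hi, rfl⟩
      have hi' : (i : ℕ) < A.toList.length := hi.trans_eq A.length_toList.symm
      have h : (A.toList ++ (U \ A).toList)[(i : ℕ)]'(i.2.trans_eq hlen.symm) ∈ A.toList := by
        rw [List.getElem_append_left hi']
        exact List.getElem_mem hi'
      exact mem_toList.1 h
    · intro hx
      obtain ⟨n, hn, rfl⟩ := List.getElem_of_mem (mem_toList.2 hx)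
      have hn' : n < #A := hn.trans_eq A.length_toList
      exact ⟨⟨n, hn'.trans_le (card_le_card hA)⟩, hn', List.getElem_append_left hn⟩

/-- Transported initial segments of the colexicographic order in which the elements of `A` precede
those of `U \ A`: `C r s` is a family of `s` sets of size `r`, and replacing families of subsets
of `U` by these families preserves inclusions of shadows. -/
theorem exists_colex_compression {V : Type*} [DecidableEq V] {U A : Finset V} (hA : A ⊆ U) :
    ∃ C : ℕ → ℕ → Finset (Finset V),
      (∀ r s, C r s ⊆ U.powersetCard r) ∧
      (∀ r s, s ≤ (#U).choose r → #(C r s) = s) ∧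
      (∀ r s, s ≤ (#U).choose r → s ≤ (#A).choose r → C r s ⊆ A.powersetCard r) ∧
      (∀ r s, s ≤ (#U).choose r → (#A).choose r ≤ s → A.powersetCard r ⊆ C r s) ∧
      (∀ r j (𝒯 𝒢 : Finset (Finset V)), 𝒯 ⊆ U.powersetCard r → 𝒢 ⊆ U.powersetCard j →
        (∀ T ∈ 𝒯, ∀ S ⊆ T, #S = j → S ∈ 𝒢) →
        ∀ T ∈ C r #𝒯, ∀ S ⊆ T, #S = j → S ∈ C j #𝒢) := by
  obtain ⟨g, hgU, hgA⟩ := exists_enumeration hA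
  have hD : ∀ r s, ∃ 𝒟 : Finset (Finset (Fin #U)), s ≤ (#U).choose r →
      Colex.IsInitSeg 𝒟 r ∧ #𝒟 = s := fun r s => by
    by_cases h : s ≤ (#U).choose r
    · exact (exists_isInitSeg_card h).imp fun _ h _ => h
    · exact ⟨∅, fun h' => absurd h' h⟩
  choose D hD using hD
  let P := fun r => ({i | (i : ℕ) < #A} : Finset (Fin #U)).powersetCard r
  have hP : ∀ r, #(P r) = (#A).choose r := fun r => by
    rw [card_powersetCard]; congr 1; rw [← card_map g, hgA]
  have hmap : ∀ r (𝒯 : Finset (Finset V)), 𝒯 ⊆ U.powersetCard r →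
      #({S | S.map g ∈ 𝒯} : Finset (Finset (Fin #U))) = #𝒯 := fun r 𝒯 h => by
    rw [← card_map (mapEmbedding g).toEmbedding]
    congr 1
    ext T
    simp only [mem_map, mem_filter, mem_univ, true_and, RelEmbedding.coe_toEmbedding,
      mapEmbedding_apply]
    refine ⟨by rintro ⟨S, hS, rfl⟩; exact hS, fun hT => ?_⟩
    have hTU := (mem_powersetCard.1 (h hT)).1
    rw [← hgU, subset_map_iff] at hTU
    obtain ⟨S, -, rfl⟩ := hTU
    exact ⟨S, hT, rfl⟩
  have hle : ∀ r (𝒯 : Finset (Finset V)), 𝒯 ⊆ U.powersetCard r → #𝒯 ≤ (#U).choose r :=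
    fun r 𝒯 h => (card_le_card h).trans_eq (card_powersetCard _ _)
  refine ⟨fun r s => if s ≤ (#U).choose r then (D r s).map (mapEmbedding g).toEmbedding else ∅,
    fun r s => ?_, fun r s hs => ?_, fun r s hs hsA => ?_, fun r s hs hsA => ?_,
    fun r j 𝒯 𝒢 h𝒯 h𝒢 h => ?_⟩
  · dsimp only
    split_ifs with hs
    · intro T hT
      obtain ⟨S, hS, rfl⟩ := mem_map.1 hT
      refine mem_powersetCard.2 ⟨?_, ?_⟩
      · conv_rhs => rw [← hgU]
        exact map_subset_map.2 (subset_univ S)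
      · exact (card_map g).trans ((hD r s hs).1.1 hS)
    · exact empty_subset _
  · dsimp only
    rw [if_pos hs, card_map, (hD r s hs).2]
  · dsimp only
    rw [if_pos hs]
    intro T hT
    obtain ⟨S, hS, rfl⟩ := mem_map.1 hT
    have := isInitSeg_subset_of_card_le (hD r s hs).1 (isInitSeg_powersetCard_lt #A r)
      (by rw [(hD r s hs).2]; exact hsA.trans_eq (hP r).symm) hS
    rw [mem_powersetCard] at this ⊢
    refine ⟨?_, (card_map g).trans this.2⟩
    conv_rhs => rw [← hgA]
    exact map_subset_map.2 this.1
  · dsimp only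
    rw [if_pos hs]
    intro T hT
    obtain ⟨hTA, hTr⟩ := mem_powersetCard.1 hT
    rw [← hgA, subset_map_iff] at hTA
    obtain ⟨S, hS, rfl⟩ := hTA
    refine mem_map.2 ⟨S, ?_, rfl⟩
    refine isInitSeg_subset_of_card_le (isInitSeg_powersetCard_lt #A r) (hD r s hs).1
      (by rw [(hD r s hs).2]; exact (hP r).trans_le hsA) ?_
    exact mem_powersetCard.2 ⟨hS, by rwa [card_map] at hTr⟩
  · dsimp only
    rw [if_pos (hle r 𝒯 h𝒯), if_pos (hle j 𝒢 h𝒢)]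
    intro T hT S hST hS
    obtain ⟨T, hTD, rfl⟩ := mem_map.1 hT
    rw [RelEmbedding.coe_toEmbedding, mapEmbedding_apply, subset_map_iff] at hST
    obtain ⟨S, hST, rfl⟩ := hST
    rw [card_map] at hS
    refine mem_map.2 ⟨S, ?_, rfl⟩
    refine subset_mem_of_isInitSeg (r := r) (𝒯 := ({S | S.map g ∈ 𝒯} : Finset (Finset (Fin #U))))
      (𝒢 := ({S | S.map g ∈ 𝒢} : Finset (Finset (Fin #U)))) ?_ ?_ (hD r _ (hle r 𝒯 h𝒯)).1
      (hD j _ (hle j 𝒢 h𝒢)).1 ?_ ?_ hTD hST hS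
    · intro R hR
      rw [mem_coe, mem_filter] at hR
      rw [← card_map g, (mem_powersetCard.1 (h𝒯 hR.2)).2]
    · intro T hT S hST hS
      simp only [mem_filter, mem_univ, true_and] at hT ⊢
      exact h _ hT _ (map_subset_map.2 hST) (by rwa [card_map])
    · rw [(hD r _ (hle r 𝒯 h𝒯)).2, hmap r 𝒯 h𝒯]
    · rw [(hD j _ (hle j 𝒢 h𝒢)).2, hmap j 𝒢 h𝒢]

theorem card_filter_sdiff_eq_le {V : Type*} [DecidableEq V] {U X : Finset V}
    {P 𝒯 : Finset (Finset V)} (h : ∀ S ∈ P, S \ U = X → S ∩ U ∈ 𝒯) :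
    #{S ∈ P | S \ U = X} ≤ #𝒯 := by
  refine card_le_card_of_injOn (· ∩ U) (fun S hS => ?_) fun S hS S' hS' hSS' => ?_
  · rw [mem_coe, mem_filter] at hS
    exact h S hS.1 hS.2
  · rw [mem_coe, mem_filter] at hS hS'
    rw [← sdiff_union_inter S U, ← sdiff_union_inter S' U, hS.2, hS'.2]
    exact congrArg (X ∪ ·) hSS'

theorem card_le_card_filter_sdiff_eq {V : Type*} [DecidableEq V] {U X : Finset V}
    {Q 𝒯 : Finset (Finset V)} (hX : Disjoint X U) (h𝒯 : ∀ T ∈ 𝒯, T ⊆ U)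
    (h : ∀ T ∈ 𝒯, X ∪ T ∈ Q) : #𝒯 ≤ #{S ∈ Q | S \ U = X} := by
  have hinter : ∀ T ∈ 𝒯, (X ∪ T) ∩ U = T := fun T hT => by
    rw [union_inter_distrib_right, disjoint_iff_inter_eq_empty.1 hX, empty_union,
      inter_eq_left.2 (h𝒯 T hT)]
  refine card_le_card_of_injOn (X ∪ ·) (fun T hT => ?_) fun T hT T' hT' hTT' => ?_
  · refine mem_coe.2 (mem_filter.2 ⟨h T hT, ?_⟩)
    rw [union_sdiff_distrib, sdiff_eq_self_of_disjoint hX, sdiff_eq_empty_iff_subset.2 (h𝒯 T hT),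
      union_empty]
  · rw [← hinter T hT, ← hinter T' hT']
    exact congrArg (· ∩ U) hTT'

theorem card_le_card_of_sdiff_fibers {V : Type*} [DecidableEq V] [Fintype V] (U : Finset V)
    {P Q : Finset (Finset V)} (h : ∀ X, #{S ∈ P | S \ U = X} ≤ #{S ∈ Q | S \ U = X}) :
    #P ≤ #Q := by
  rw [card_eq_sum_card_fiberwise (f := (· \ U)) (s := P) (t := univ) (fun _ _ => by simp),
    card_eq_sum_card_fiberwise (f := (· \ U)) (s := Q) (t := univ) (fun _ _ => by simp)]
  exact sum_le_sum fun X _ => h X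

theorem copiesAt_eq_card {V : Type*} [DecidableEq V] [Fintype V] (E : Finset (Finset V))
    (ℓ k : ℕ) (v : V) : copiesAt E ℓ k v = #{S : Finset V | v ∈ S ∧ IsCopy E ℓ k S} := by
  unfold copiesAt
  congr!

theorem choose_le_copiesAt_s12 {V : Type*} [DecidableEq V] [Fintype V] {E : Finset (Finset V)}
    {ℓ k t : ℕ} (hk : 0 < k) {B : Finset V} {w : V} (hw : w ∈ B) (hB : t + 1 ≤ #B)
    (hE : ∀ f ⊆ B, #f = ℓ → f ∈ E) : t.choose (k - 1) ≤ copiesAt E ℓ k w := by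
  have ht : t ≤ #(B.erase w) := by rw [card_erase_of_mem hw]; omega
  refine (Nat.choose_le_choose (k - 1) ht).trans ?_
  rw [← card_powersetCard, copiesAt_eq_card]
  refine card_le_card_of_injOn (insert w) (fun S hS => ?_) fun S hS S' hS' h => ?_
  · obtain ⟨hSB, hS⟩ := mem_powersetCard.1 hS
    have hwS : w ∉ S := fun h => notMem_erase w B (hSB h)
    refine mem_coe.2 (mem_filter.2 ⟨mem_univ _, mem_insert_self _ _, ?_, fun f hf => hE f ?_⟩)
    · rw [card_insert_of_notMem hwS]; omega
    · exact hf.trans (insert_subset hw (hSB.trans (erase_subset _ _)))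
  · have hwS : w ∉ S := fun h => notMem_erase w B ((mem_powersetCard.1 hS).1 h)
    have hwS' : w ∉ S' := fun h => notMem_erase w B ((mem_powersetCard.1 hS').1 h)
    rw [← erase_insert hwS, ← erase_insert hwS', h]

/-- If an edge inside the union of two copies of `K_{t+1}^ℓ` is contained in neither copy, then
compressing the edges that leave the union towards the first copy, and deleting the edges of the
union that lie in neither copy, preserves the degree condition and lowers the number of edges. -/
theorem exists_degCond_card_lt {V : Type*} [DecidableEq V] [Fintype V] {E : Finset (Finset V)}
    {k ℓ t : ℕ} (hkl : ℓ < k) (hl : 0 < ℓ) (hdeg : DegCond E ℓ k t)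
    {A₁ A₂ e : Finset V} (h₁ : IsCopy E ℓ (t + 1) A₁) (h₂ : IsCopy E ℓ (t + 1) A₂)
    (he : e ∈ E) (heA : e ⊆ A₁ ∪ A₂) (he₁ : ¬e ⊆ A₁) (he₂ : ¬e ⊆ A₂) :
    ∃ E' : Finset (Finset V), IsLGraph ℓ E' ∧ DegCond E' ℓ k t ∧ #E' < #E := by
  set U := A₁ ∪ A₂ with hU
  have hA₁ : A₁ ⊆ U := subset_union_left
  have hA₂ : A₂ ⊆ U := subset_union_right
  obtain ⟨C, hCU, hCcard, hCA, hAC, hshadow⟩ := exists_colex_compression hA₁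
  rw [h₁.1] at hCA hAC
  let G := fun Y : Finset V => {Z ∈ U.powersetCard (ℓ - #Y) | Y ∪ Z ∈ E}
  let K := fun X : Finset V => {T ∈ U.powersetCard (k - #X) | IsCopy E ℓ k (X ∪ T)}
  have hGU : ∀ Y, G Y ⊆ U.powersetCard (ℓ - #Y) := fun Y => filter_subset _ _
  have hKU : ∀ X, K X ⊆ U.powersetCard (k - #X) := fun X => filter_subset _ _
  have hGle : ∀ Y, #(G Y) ≤ (#U).choose (ℓ - #Y) :=
    fun Y => (card_le_card (hGU Y)).trans_eq (card_powersetCard _ _)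
  have hKle : ∀ X, #(K X) ≤ (#U).choose (k - #X) :=
    fun X => (card_le_card (hKU X)).trans_eq (card_powersetCard _ _)
  have hKG : ∀ X Y, Disjoint X U → Y ⊆ X → #Y ≤ ℓ →
      ∀ T ∈ K X, ∀ S ⊆ T, #S = ℓ - #Y → S ∈ G Y := by
    intro X Y hX hYX hY T hT S hST hS
    obtain ⟨hTU, hT⟩ := mem_filter.1 hT
    have hSU : S ⊆ U := hST.trans (mem_powersetCard.1 hTU).1
    refine mem_filter.2 ⟨mem_powersetCard.2 ⟨hSU, hS⟩, hT.2 _ (union_subset_union hYX hST) ?_⟩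
    rw [card_union_of_disjoint (hX.mono hYX hSU)]
    omega
  let I := A₁.powersetCard ℓ ∪ A₂.powersetCard ℓ
  let O : Finset (Finset V) :=
    {f | #f = ℓ ∧ ¬f ⊆ U ∧ f ∩ U ∈ C (ℓ - #(f \ U)) #(G (f \ U))}
  have hsub₁ : ∀ f ⊆ A₁, #f = ℓ → f ∈ I ∪ O := fun f hf hfℓ =>
    mem_union_left _ (mem_union_left _ (mem_powersetCard.2 ⟨hf, hfℓ⟩))
  have hsub₂ : ∀ f ⊆ A₂, #f = ℓ → f ∈ I ∪ O := fun f hf hfℓ =>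
    mem_union_left _ (mem_union_right _ (mem_powersetCard.2 ⟨hf, hfℓ⟩))
  have hI : #I < #{f ∈ E | f ⊆ U} := by
    refine card_lt_card ((ssubset_iff_of_subset fun f hf => ?_).2
      ⟨e, mem_filter.2 ⟨he, heA⟩, fun h => ?_⟩)
    · rcases mem_union.1 hf with hf | hf <;> rw [mem_powersetCard] at hf
      · exact mem_filter.2 ⟨h₁.2 f hf.1 hf.2, hf.1.trans hA₁⟩
      · exact mem_filter.2 ⟨h₂.2 f hf.1 hf.2, hf.1.trans hA₂⟩
    · rcases mem_union.1 h with h | h <;> rw [mem_powersetCard] at h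
      exacts [he₁ h.1, he₂ h.1]
  have hO : #O ≤ #{f ∈ E | ¬f ⊆ U} := by
    refine card_le_card_of_sdiff_fibers U fun Y => ?_
    by_cases hY : Disjoint Y U ∧ Y.Nonempty
    · calc #{f ∈ O | f \ U = Y} ≤ #(C (ℓ - #Y) #(G Y)) :=
            card_filter_sdiff_eq_le fun f hf hfY => hfY ▸ (mem_filter.1 hf).2.2.2
        _ = #(G Y) := hCcard _ _ (hGle Y)
        _ ≤ _ := card_le_card_filter_sdiff_eq hY.1
            (fun Z hZ => (mem_powersetCard.1 (hGU Y hZ)).1) fun Z hZ =>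
              mem_filter.2 ⟨(mem_filter.1 hZ).2, fun h => ?_⟩
      obtain ⟨y, hy⟩ := hY.2
      exact disjoint_left.1 hY.1 hy (h (mem_union_left _ hy))
    · rw [filter_eq_empty_iff.2, card_empty]
      · exact Nat.zero_le _
      · rintro f hf rfl
        refine hY ⟨sdiff_disjoint, sdiff_nonempty.2 (mem_filter.1 hf).2.2.1⟩
  refine ⟨I ∪ O, fun f hf => ?_, fun w => ?_, ?_⟩
  · rcases mem_union.1 hf with hf | hf
    · rcases mem_union.1 hf with hf | hf <;> exact (mem_powersetCard.1 hf).2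
    · exact (mem_filter.1 hf).2.1
  · by_cases hwU : w ∈ U
    · rcases mem_union.1 hwU with hw | hw
      · exact choose_le_copiesAt_s12 (by omega) hw h₁.1.ge hsub₁
      · exact choose_le_copiesAt_s12 (by omega) hw h₂.1.ge hsub₂
    by_cases hkt : t + 1 < k
    · rw [Nat.choose_eq_zero_of_lt (by omega)]
      exact Nat.zero_le _
    by_cases hfull : ∃ X, w ∈ X ∧ Disjoint X U ∧ ℓ ≤ k - #X ∧ (t + 1).choose (k - #X) ≤ #(K X)
    · obtain ⟨X, hwX, hX, hℓX, hKX⟩ := hfull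
      refine choose_le_copiesAt_s12 (by omega) (mem_insert_self w A₁)
        (h₁.1.ge.trans (card_le_card (subset_insert _ _))) fun f hf hfℓ => ?_
      by_cases hwf : w ∈ f
      · have hfA : f.erase w ⊆ A₁ := subset_insert_iff.1 hf
        have hdiff : f \ U = {w} := by
          rw [← insert_erase hwf, insert_sdiff_of_notMem _ hwU,
            sdiff_eq_empty_iff_subset.2 (hfA.trans hA₁)]
          rfl
        have hinter : f ∩ U = f.erase w := by
          conv_lhs => rw [← insert_erase hwf, insert_inter_of_notMem hwU]
          exact inter_eq_left.2 (hfA.trans hA₁)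
        refine mem_union_right _ (mem_filter.2 ⟨mem_univ _, hfℓ, fun h => hwU (h hwf), ?_⟩)
        rw [hdiff, hinter]
        have hcard : #(f.erase w) = ℓ - #{w} := by
          rw [card_erase_of_mem hwf, hfℓ, card_singleton]
        obtain ⟨R, hfR, hRA, hR⟩ := exists_subsuperset_card_eq hfA (n := k - #X)
          (by rw [card_erase_of_mem hwf]; omega) (by rw [h₁.1]; omega)
        exact hshadow _ _ (K X) (G {w}) (hKU X) (hGU {w})
          (hKG X {w} hX (singleton_subset_iff.2 hwX) (by rw [card_singleton]; omega)) R
          (hAC _ _ (hKle X) hKX (mem_powersetCard.2 ⟨hRA, hR⟩)) _ hfR hcard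
      · exact hsub₁ f ((subset_insert_iff_of_notMem hwf).1 hf) hfℓ
    push Not at hfull
    refine (hdeg w).trans ?_
    rw [copiesAt_eq_card, copiesAt_eq_card]
    refine card_le_card_of_sdiff_fibers U fun X => ?_
    by_cases hX : Disjoint X U ∧ w ∈ X ∧ #X ≤ k
    · obtain ⟨hX, hwX, hXk⟩ := hX
      refine (card_filter_sdiff_eq_le (𝒯 := K X) ?_).trans ?_
      · rintro S hS rfl
        obtain ⟨-, -, hS⟩ := mem_filter.1 hS
        refine mem_filter.2 ⟨mem_powersetCard.2 ⟨inter_subset_right, ?_⟩, ?_⟩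
        · have := card_sdiff_add_card_inter S U
          rw [hS.1] at this
          omega
        · rwa [sdiff_union_inter]
      rw [← hCcard _ _ (hKle X)]
      refine card_le_card_filter_sdiff_eq hX (fun T hT => (mem_powersetCard.1 (hCU _ _ hT)).1)
        fun T hT => mem_filter.2 ⟨mem_univ _, mem_union_left _ hwX, ?_, fun f hf hfℓ => ?_⟩
      all_goals obtain ⟨hTU, hTk⟩ := mem_powersetCard.1 (hCU _ _ hT)
      · rw [card_union_of_disjoint (hX.mono_right hTU)]
        omega
      by_cases hfU : f ⊆ U
      · have hfT : f ⊆ T := fun x hx =>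
          (mem_union.1 (hf hx)).resolve_left fun h => disjoint_left.1 hX h (hfU hx)
        have hℓX : ℓ ≤ k - #X := by rw [← hfℓ, ← hTk]; exact card_le_card hfT
        exact hsub₁ f (hfT.trans
          (mem_powersetCard.1 (hCA _ _ (hKle X) (hfull X hwX hX hℓX).le hT)).1) hfℓ
      · have hfc := card_sdiff_add_card_inter f U
        refine mem_union_right _ (mem_filter.2 ⟨mem_univ _, hfℓ, hfU, ?_⟩)
        refine hshadow _ _ (K X) (G (f \ U)) (hKU X) (hGU _)
          (hKG X (f \ U) hX (fun x hx => ?_) (by omega)) T hT _ (fun x hx => ?_) (by omega)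
        · rw [mem_sdiff] at hx
          exact (mem_union.1 (hf hx.1)).resolve_right fun h => hx.2 (hTU h)
        · rw [mem_inter] at hx
          exact (mem_union.1 (hf hx.1)).resolve_left fun h => disjoint_left.1 hX h hx.2
    · rw [filter_eq_empty_iff.2, card_empty]
      · exact Nat.zero_le _
      · rintro S hS rfl
        obtain ⟨-, hwS, hS⟩ := mem_filter.1 hS
        exact hX ⟨sdiff_disjoint, mem_sdiff.2 ⟨hwS, hwU⟩, hS.1 ▸ card_le_card sdiff_subset⟩
  · calc #(I ∪ O) ≤ #I + #O := card_union_le _ _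
      _ < #{f ∈ E | f ⊆ U} + #{f ∈ E | ¬f ⊆ U} := add_lt_add_of_lt_of_le hI hO
      _ = #E := card_filter_add_card_filter_not _

/-- If `A₁ ≠ A₂` are two copies of `K_{t+1}^ℓ` in an extremal `ℓ`-graph `G`, then `G` has no
edge `e ⊆ A₁ ∪ A₂` meeting both `A₁ \ A₂` and `A₂ \ A₁` (Lemma 13 of the paper). -/
theorem stmt12 (k ℓ : ℕ) (hkl : ℓ < k) (hl : 2 ≤ ℓ) :
    ∃ t₀ : ℕ, ∀ t : ℕ, t₀ ≤ t →
      ∀ (V : Type) [DecidableEq V] [Fintype V],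
      (((t + 1) ^ 2 * Nat.choose (t - 1) (ℓ - 2) : ℕ) : ℚ) / 4 + 2 * (t : ℚ) <
        (Fintype.card V : ℚ) →
      ∀ E : Finset (Finset V), IsExtremal E ℓ k t →
      ∀ A₁ A₂ : Finset V, A₁ ≠ A₂ →
        IsCopy E ℓ (t + 1) A₁ → IsCopy E ℓ (t + 1) A₂ →
        ∀ e ∈ E, e ⊆ A₁ ∪ A₂ →
          ¬((e ∩ (A₁ \ A₂)).Nonempty ∧ (e ∩ (A₂ \ A₁)).Nonempty) := by
  refine ⟨0, fun t _ V _ _ _ E hE A₁ A₂ _ h₁ h₂ e he heA hcross => ?_⟩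
  obtain ⟨⟨x, hx⟩, y, hy⟩ := hcross
  rw [mem_inter, mem_sdiff] at hx hy
  obtain ⟨E', hE', hdeg, hlt⟩ := exists_degCond_card_lt hkl (by omega) hE.2.1 h₁ h₂ he heA
    (fun h => hy.2.2 (h hy.1)) (fun h => hx.2.2 (h hx.1))
  exact absurd (hE.2.2 E' hE' hdeg) (not_le.2 hlt)
end
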